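/- Let k₀, k₁ : [0,1] × [0,1] → ℝ be continuous, φ : [0,1] → [0,1] continuous, M > 0, L₀, L₁, L₂, L₃ ≥ 0, and define M₀, K₀, K₁, D_M, B[0,M] as usual. Suppose f is continuous on D_M with |f| ≤ M on D_M and satisfies the Lipschitz condition |f(x,u₂,y₂,v₂,z₂) − f(x,u₁,y₁,v₁,z₁)| ≤ L₀|u₂−u₁| + L₁|y₂−y₁| + L₂|v₂−v₁| + L₃|z₂−z₁| for all points of D_M. Then the operator A defined by (Aψ)(x) = f(x, u(x), u(φ(x)), ∫₀¹ k₀(x,t) u(t) dt, ∫₀¹ k₁(x,t) u(φ(t)) dt), with u(x) = ∫₀¹ G(x,s) ψ(s) ds, satisfies ‖Aψ₂ − Aψ₁‖ ≤ q ‖ψ₂ − ψ₁‖ for all ψ₁, ψ₂ ∈ B[0,M], where q = (L₀ + L₁ + L₂K₀ + L₃K₁) M₀. -/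

import Mathlib

/-- The Green function of `u'''' = 0` on `[0,1]` with boundary conditions
`u(0) = u(1) = u''(0) = u''(1) = 0`. -/
noncomputable def greenG (x s : ℝ) : ℝ :=
  if s ≤ x then 1 / 6 * s * (x - 1) * (x ^ 2 - x + s ^ 2)
  else 1 / 6 * x * (s - 1) * (s ^ 2 - s + x ^ 2)

/-- `u(x) = ∫₀¹ G(x,s) ψ(s) ds`. -/
noncomputable def solOp (ψ : ℝ → ℝ) (x : ℝ) : ℝ :=
  ∫ s in (0 : ℝ)..1, greenG x s * ψ s

/-- The operator `A`:
`(Aψ)(x) = f(x, u(x), u(φ(x)), ∫₀¹ k₀(x,t) u(t) dt, ∫₀¹ k₁(x,t) u(φ(t)) dt)` with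
`u(x) = ∫₀¹ G(x,s) ψ(s) ds`. -/
noncomputable def Aop (f : ℝ → ℝ → ℝ → ℝ → ℝ → ℝ) (k₀ k₁ : ℝ → ℝ → ℝ) (φ : ℝ → ℝ)
    (ψ : ℝ → ℝ) : ℝ → ℝ := fun x =>
  f x (solOp ψ x) (solOp ψ (φ x))
    (∫ t in (0 : ℝ)..1, k₀ x t * solOp ψ t)
    (∫ t in (0 : ℝ)..1, k₁ x t * solOp ψ (φ t))

/-- The domain `D_M`. -/
def DM (M₀ K₀ K₁ M : ℝ) : Set (ℝ × ℝ × ℝ × ℝ × ℝ) :=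
  {p | p.1 ∈ Set.Icc (0 : ℝ) 1 ∧ |p.2.1| ≤ M₀ * M ∧ |p.2.2.1| ≤ M₀ * M ∧
    |p.2.2.2.1| ≤ M₀ * K₀ * M ∧ |p.2.2.2.2| ≤ M₀ * K₁ * M}

theorem abs_integral_mul_le {g h : ℝ → ℝ} {c : ℝ} (hg : ContinuousOn g (Set.Icc 0 1))
    (hc : ∀ t ∈ Set.Icc (0 : ℝ) 1, |h t| ≤ c) :
    |∫ t in (0 : ℝ)..1, g t * h t| ≤ (∫ t in (0 : ℝ)..1, |g t|) * c := by
  rw [← intervalIntegral.integral_mul_const, ← Real.norm_eq_abs]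
  refine intervalIntegral.norm_integral_le_of_norm_le zero_le_one
    (Filter.Eventually.of_forall fun t ht => ?_) ?_
  · rw [Real.norm_eq_abs, abs_mul]
    exact mul_le_mul_of_nonneg_left (hc t (Set.Ioc_subset_Icc_self ht)) (abs_nonneg _)
  · exact (hg.abs.mul continuousOn_const).intervalIntegrable_of_Icc zero_le_one

theorem abs_integral_mul_sub_le {g h₁ h₂ : ℝ → ℝ} {c : ℝ} (hg : ContinuousOn g (Set.Icc 0 1))
    (h₁c : ContinuousOn h₁ (Set.Icc 0 1)) (h₂c : ContinuousOn h₂ (Set.Icc 0 1))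
    (hc : ∀ t ∈ Set.Icc (0 : ℝ) 1, |h₂ t - h₁ t| ≤ c) :
    |(∫ t in (0 : ℝ)..1, g t * h₂ t) - ∫ t in (0 : ℝ)..1, g t * h₁ t| ≤
      (∫ t in (0 : ℝ)..1, |g t|) * c := by
  have hi : ∀ {h : ℝ → ℝ}, ContinuousOn h (Set.Icc 0 1) →
      IntervalIntegrable (fun t => g t * h t) MeasureTheory.volume 0 1 :=
    fun hh => (hg.mul hh).intervalIntegrable_of_Icc zero_le_one
  rw [← intervalIntegral.integral_sub (hi h₂c) (hi h₁c)]
  simp_rw [← mul_sub]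
  exact abs_integral_mul_le hg hc

theorem continuous_uncurry_greenG : Continuous fun p : ℝ × ℝ => greenG p.1 p.2 := by
  unfold greenG
  refine Continuous.if_le (by fun_prop) (by fun_prop) continuous_snd continuous_fst ?_
  intro p hp
  rw [hp]

theorem continuous_greenG (x : ℝ) : Continuous (greenG x) :=
  continuous_uncurry_greenG.comp (Continuous.prodMk_right x)

theorem continuous_solOp {ψ : ℝ → ℝ} (hψ : ContinuousOn ψ (Set.Icc 0 1)) :
    Continuous (solOp ψ) := by
  set ψ' : ℝ → ℝ := Set.IccExtend (zero_le_one (α := ℝ)) ((Set.Icc 0 1).domRestrict ψ) with hψ'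
  have hc : Continuous ψ' := hψ.domRestrict.Icc_extend'
  have heq : solOp ψ = fun x => ∫ s in (0 : ℝ)..1, greenG x s * ψ' s := by
    funext x
    refine intervalIntegral.integral_congr fun s hs => ?_
    rw [Set.uIcc_of_le zero_le_one] at hs
    simp only [hψ', Set.IccExtend_of_mem _ _ hs, Set.domRestrict_apply]
  rw [heq]
  exact intervalIntegral.continuous_parametric_intervalIntegral_of_continuous'
    (continuous_uncurry_greenG.mul (hc.comp continuous_snd)) 0 1

theorem continuousOn_section {k : ℝ → ℝ → ℝ}
    (hk : ContinuousOn (fun p : ℝ × ℝ => k p.1 p.2) (Set.Icc 0 1 ×ˢ Set.Icc 0 1))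
    {x : ℝ} (hx : x ∈ Set.Icc (0 : ℝ) 1) : ContinuousOn (k x) (Set.Icc 0 1) :=
  hk.comp (Continuous.prodMk_right x).continuousOn fun _ ht => ⟨hx, ht⟩

/-- under the Lipschitz condition on `f` in `D_M`, the operator `A` satisfies
`‖Aψ₂ − Aψ₁‖ ≤ q ‖ψ₂ − ψ₁‖` on `B[0,M]`, where `q = (L₀ + L₁ + L₂K₀ + L₃K₁) M₀`.
(`d` stands for an arbitrary upper bound of `|ψ₂ - ψ₁|` on `[0,1]`; taking the maximum
norm `d = ‖ψ₂ − ψ₁‖` yields the stated contraction estimate.) -/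
theorem Aop_contraction (k₀ k₁ : ℝ → ℝ → ℝ)
    (hk₀ : ContinuousOn (fun p : ℝ × ℝ => k₀ p.1 p.2) (Set.Icc 0 1 ×ˢ Set.Icc 0 1))
    (hk₁ : ContinuousOn (fun p : ℝ × ℝ => k₁ p.1 p.2) (Set.Icc 0 1 ×ˢ Set.Icc 0 1))
    (φ : ℝ → ℝ) (hφ : ContinuousOn φ (Set.Icc 0 1))
    (hφmap : Set.MapsTo φ (Set.Icc (0 : ℝ) 1) (Set.Icc (0 : ℝ) 1))
    (M M₀ K₀ K₁ L₀ L₁ L₂ L₃ : ℝ) (hM : 0 < M)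
    (hL₀ : 0 ≤ L₀) (hL₁ : 0 ≤ L₁) (hL₂ : 0 ≤ L₂) (hL₃ : 0 ≤ L₃)
    (hM₀ : IsGreatest {y : ℝ | ∃ x ∈ Set.Icc (0 : ℝ) 1, y = ∫ s in (0 : ℝ)..1, |greenG x s|} M₀)
    (hK₀ : IsGreatest {y : ℝ | ∃ x ∈ Set.Icc (0 : ℝ) 1, y = ∫ s in (0 : ℝ)..1, |k₀ x s|} K₀)
    (hK₁ : IsGreatest {y : ℝ | ∃ x ∈ Set.Icc (0 : ℝ) 1, y = ∫ s in (0 : ℝ)..1, |k₁ x s|} K₁)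
    (f : ℝ → ℝ → ℝ → ℝ → ℝ → ℝ)
    (hfc : ContinuousOn (fun p : ℝ × ℝ × ℝ × ℝ × ℝ => f p.1 p.2.1 p.2.2.1 p.2.2.2.1 p.2.2.2.2)
      (DM M₀ K₀ K₁ M))
    (hfb : ∀ x u y v z : ℝ, (x, u, y, v, z) ∈ DM M₀ K₀ K₁ M → |f x u y v z| ≤ M)
    (hfL : ∀ x u₁ y₁ v₁ z₁ u₂ y₂ v₂ z₂ : ℝ,
      (x, u₁, y₁, v₁, z₁) ∈ DM M₀ K₀ K₁ M → (x, u₂, y₂, v₂, z₂) ∈ DM M₀ K₀ K₁ M →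
      |f x u₂ y₂ v₂ z₂ - f x u₁ y₁ v₁ z₁| ≤
        L₀ * |u₂ - u₁| + L₁ * |y₂ - y₁| + L₂ * |v₂ - v₁| + L₃ * |z₂ - z₁|) :
    ∀ ψ₁ ψ₂ : ℝ → ℝ, ContinuousOn ψ₁ (Set.Icc 0 1) → ContinuousOn ψ₂ (Set.Icc 0 1) →
      (∀ x ∈ Set.Icc (0 : ℝ) 1, |ψ₁ x| ≤ M) → (∀ x ∈ Set.Icc (0 : ℝ) 1, |ψ₂ x| ≤ M) →
      ∀ d : ℝ, (∀ x ∈ Set.Icc (0 : ℝ) 1, |ψ₂ x - ψ₁ x| ≤ d) →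
      ∀ x ∈ Set.Icc (0 : ℝ) 1,
        |Aop f k₀ k₁ φ ψ₂ x - Aop f k₀ k₁ φ ψ₁ x| ≤ (L₀ + L₁ + L₂ * K₀ + L₃ * K₁) * M₀ * d := by
  intro ψ₁ ψ₂ hψ₁ hψ₂ hb₁ hb₂ d hd x hx
  have hd₀ : 0 ≤ d := (abs_nonneg _).trans (hd x hx)
  have hM₀_nonneg : 0 ≤ M₀ := by
    obtain ⟨y, -, rfl⟩ := hM₀.1
    exact intervalIntegral.integral_nonneg zero_le_one fun _ _ => abs_nonneg _
  have bound_sol : ∀ {ψ : ℝ → ℝ}, (∀ t ∈ Set.Icc (0 : ℝ) 1, |ψ t| ≤ M) →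
      ∀ t ∈ Set.Icc (0 : ℝ) 1, |solOp ψ t| ≤ M₀ * M := fun hb t ht =>
    (abs_integral_mul_le (continuous_greenG t).continuousOn hb).trans
      (mul_le_mul_of_nonneg_right (hM₀.2 ⟨t, ht, rfl⟩) hM.le)
  have diff_sol : ∀ t ∈ Set.Icc (0 : ℝ) 1, |solOp ψ₂ t - solOp ψ₁ t| ≤ M₀ * d := fun t ht =>
    (abs_integral_mul_sub_le (continuous_greenG t).continuousOn hψ₁ hψ₂ hd).trans
      (mul_le_mul_of_nonneg_right (hM₀.2 ⟨t, ht, rfl⟩) hd₀)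
  have hk₀x := continuousOn_section hk₀ hx
  have hk₁x := continuousOn_section hk₁ hx
  have mem_DM : ∀ {ψ : ℝ → ℝ}, (∀ t ∈ Set.Icc (0 : ℝ) 1, |ψ t| ≤ M) →
      (x, solOp ψ x, solOp ψ (φ x), (∫ t in (0 : ℝ)..1, k₀ x t * solOp ψ t),
        ∫ t in (0 : ℝ)..1, k₁ x t * solOp ψ (φ t)) ∈ DM M₀ K₀ K₁ M := by
    intro ψ hb
    have hMM : 0 ≤ M₀ * M := mul_nonneg hM₀_nonneg hM.le
    refine ⟨hx, bound_sol hb x hx, bound_sol hb _ (hφmap hx), ?_, ?_⟩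
    · rw [mul_right_comm, mul_comm _ K₀]
      exact (abs_integral_mul_le hk₀x (bound_sol hb)).trans
        (mul_le_mul_of_nonneg_right (hK₀.2 ⟨x, hx, rfl⟩) hMM)
    · rw [mul_right_comm, mul_comm _ K₁]
      exact (abs_integral_mul_le hk₁x fun t ht => bound_sol hb _ (hφmap ht)).trans
        (mul_le_mul_of_nonneg_right (hK₁.2 ⟨x, hx, rfl⟩) hMM)
  have hMd : 0 ≤ M₀ * d := mul_nonneg hM₀_nonneg hd₀
  have hu₁ := continuous_solOp hψ₁
  have hu₂ := continuous_solOp hψ₂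
  have diff_v := (abs_integral_mul_sub_le hk₀x hu₁.continuousOn hu₂.continuousOn diff_sol).trans
    (mul_le_mul_of_nonneg_right (hK₀.2 ⟨x, hx, rfl⟩) hMd)
  have diff_z := (abs_integral_mul_sub_le hk₁x (hu₁.comp_continuousOn hφ)
      (hu₂.comp_continuousOn hφ) fun t ht => diff_sol _ (hφmap ht)).trans
    (mul_le_mul_of_nonneg_right (hK₁.2 ⟨x, hx, rfl⟩) hMd)
  calc |Aop f k₀ k₁ φ ψ₂ x - Aop f k₀ k₁ φ ψ₁ x|
      ≤ _ := hfL _ _ _ _ _ _ _ _ _ (mem_DM hb₁) (mem_DM hb₂)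
    _ ≤ L₀ * (M₀ * d) + L₁ * (M₀ * d) + L₂ * (K₀ * (M₀ * d)) + L₃ * (K₁ * (M₀ * d)) := by
      gcongr
      · exact diff_sol x hx
      · exact diff_sol _ (hφmap hx)
      · exact diff_z
    _ = (L₀ + L₁ + L₂ * K₀ + L₃ * K₁) * M₀ * d := by ring
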